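/- arXiv:1402.4084 — 2 statements merged into one kernel-verified Lean document; each statement's English description precedes it below -/
import Mathlib

section
/- Suppose ‖x_j‖² ≤ X² for every j, where X > 0. Then for every k ≥ 1, Tr(D_k) ≤ d · max{ (3X² + √(X⁴ + 4X²c))/2 , b + X² }. -/
set_option autoImplicit false

open Matrix Finset

noncomputable section

/-- `D_0 = (bc/(c-b)) I`, `D_k = (D_{k-1}⁻¹ + c⁻¹ I)⁻¹ + x_k x_kᵀ` for `k ≥ 1`. -/
def lasecD (d : ℕ) (b c : ℝ) (x : ℕ → Fin d → ℝ) : ℕ → Matrix (Fin d) (Fin d) ℝ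
  | 0 => (b * c / (c - b)) • (1 : Matrix (Fin d) (Fin d) ℝ)
  | k + 1 => ((lasecD d b c x k)⁻¹ + c⁻¹ • (1 : Matrix (Fin d) (Fin d) ℝ))⁻¹
      + vecMulVec (x (k + 1)) (x (k + 1))

lemma lasec_step {d : ℕ} (c : ℝ) (hc : 0 < c) (D : Matrix (Fin d) (Fin d) ℝ) (hD : D.PosDef)
    (M : ℝ) (hM : 0 < M) (hT : D.trace ≤ d * M) :
    ((D⁻¹ + c⁻¹ • (1 : Matrix (Fin d) (Fin d) ℝ))⁻¹).trace ≤ d * (M * c / (M + c)) := by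
  have hS : (D + c • (1 : Matrix (Fin d) (Fin d) ℝ)).PosDef :=
    hD.add (Matrix.PosDef.one.smul hc)
  set S := D + c • (1 : Matrix (Fin d) (Fin d) ℝ) with hSdef
  have hDu : IsUnit D.det := (Matrix.isUnit_iff_isUnit_det _).1 hD.isUnit
  have hSu : IsUnit S.det := (Matrix.isUnit_iff_isUnit_det _).1 hS.isUnit
  have h1 : D⁻¹ * D = 1 := Matrix.nonsing_inv_mul _ hDu
  have h2 : S * S⁻¹ = 1 := Matrix.mul_nonsing_inv _ hSu
  have hinv : (D⁻¹ + c⁻¹ • (1 : Matrix (Fin d) (Fin d) ℝ))⁻¹ = c • (D * S⁻¹) := by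
    apply Matrix.inv_eq_right_inv
    have : (D⁻¹ + c⁻¹ • (1 : Matrix (Fin d) (Fin d) ℝ)) * (c • (D * S⁻¹)) = S * S⁻¹ := by
      rw [Matrix.mul_smul, ← Matrix.mul_assoc, ← Matrix.smul_mul, Matrix.add_mul, h1, hSdef,
        smul_add, Matrix.smul_mul, Matrix.one_mul, smul_smul, mul_inv_cancel₀ hc.ne', one_smul,
        add_comm]
    rw [this, h2]
  obtain ⟨t, ht⟩ : ∃ t, t = c / (M + c) := ⟨_, rfl⟩
  set E := t • D - ((1 - t) * c) • (1 : Matrix (Fin d) (Fin d) ℝ) with hE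
  have hEH : Eᴴ = E := by
    have := hD.isHermitian.eq
    rw [Matrix.conjTranspose_eq_transpose_of_trivial] at this
    simp [hE, this]
  have hnn : 0 ≤ (E * S⁻¹ * E).trace := by
    have := (hS.inv.posSemidef.mul_mul_conjTranspose_same E).trace_nonneg
    rwa [hEH] at this
  have hEE : E * E = (t ^ 2 • D + ((1 - t) ^ 2 * c) • (1 : Matrix (Fin d) (Fin d) ℝ)) * S
      - c • D := by
    rw [hE, hSdef]
    simp only [Matrix.add_mul, Matrix.mul_add, Matrix.sub_mul, Matrix.mul_sub, Matrix.smul_mul,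
      Matrix.mul_smul, Matrix.one_mul, Matrix.mul_one]
    module
  have htr : (E * S⁻¹ * E).trace = t ^ 2 * D.trace + (1 - t) ^ 2 * c * d
      - (c • (D * S⁻¹)).trace := by
    rw [Matrix.trace_mul_comm, ← Matrix.mul_assoc, hEE, Matrix.sub_mul, Matrix.mul_assoc, h2,
      Matrix.mul_one, Matrix.smul_mul]
    simp [Matrix.trace_add, Matrix.trace_sub, Matrix.trace_smul]
  rw [hinv]
  have h3 : t ^ 2 * D.trace ≤ t ^ 2 * (d * M) := mul_le_mul_of_nonneg_left hT (sq_nonneg t)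
  have h4 : t ^ 2 * (d * M) + (1 - t) ^ 2 * c * d = d * (M * c / (M + c)) := by
    have : M + c ≠ 0 := by positivity
    rw [ht]
    field_simp
    ring
  linarith

lemma lasec_posDef (d : ℕ) (b c : ℝ) (hb : 0 < b) (hbc : b < c) (x : ℕ → Fin d → ℝ) (k : ℕ) :
    (lasecD d b c x k).PosDef := by
  have hc : 0 < c := hb.trans hbc
  induction k with
  | zero =>
    exact Matrix.PosDef.one.smul (div_pos (mul_pos hb hc) (sub_pos.2 hbc))
  | succ k ih =>
    rw [lasecD]
    refine Matrix.PosDef.add_posSemidef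
      (Matrix.PosDef.inv (ih.inv.add (Matrix.PosDef.one.smul (inv_pos.2 hc)))) ?_
    simpa using Matrix.posSemidef_vecMulVec_self_star (x (k + 1))

/-- if `‖x_j‖² ≤ X²` for all `j`, then for every `k ≥ 1`,
`Tr(D_k) ≤ d · max{(3X² + √(X⁴ + 4X²c))/2, b + X²}`. -/
theorem lasec_trace_bound (d : ℕ) (hd : 1 ≤ d) (b c : ℝ) (hb : 0 < b) (hbc : b < c)
    (X : ℝ) (hX : 0 < X) (x : ℕ → Fin d → ℝ)
    (hx : ∀ j : ℕ, (∑ i, (x j i) ^ 2) ≤ X ^ 2) :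
    ∀ k : ℕ, 1 ≤ k →
      (lasecD d b c x k).trace ≤
        (d : ℝ) * max ((3 * X ^ 2 + Real.sqrt (X ^ 4 + 4 * X ^ 2 * c)) / 2)
          (b + X ^ 2) := by
  have hc : 0 < c := hb.trans hbc
  have hd1 : (1 : ℝ) ≤ d := by exact_mod_cast hd
  set B := max ((3 * X ^ 2 + Real.sqrt (X ^ 4 + 4 * X ^ 2 * c)) / 2) (b + X ^ 2) with hB
  have step : ∀ k M, 0 < M → (lasecD d b c x k).trace ≤ d * M →
      (lasecD d b c x (k + 1)).trace ≤ d * (M * c / (M + c) + X ^ 2) := by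
    intro k M hM hT
    have h := lasec_step c hc _ (lasec_posDef d b c hb hbc x k) M hM hT
    have h2 := hx (k + 1)
    have h3 : (vecMulVec (x (k + 1)) (x (k + 1))).trace = ∑ i, (x (k + 1) i) ^ 2 := by
      simp [Matrix.trace, vecMulVec_apply, sq]
    rw [lasecD, Matrix.trace_add, h3]
    nlinarith [sq_nonneg X]
  have hB2 : b + X ^ 2 ≤ B := le_max_right _ _
  have hB1 : (3 * X ^ 2 + Real.sqrt (X ^ 4 + 4 * X ^ 2 * c)) / 2 ≤ B := le_max_left _ _
  have hX2 : 0 < X ^ 2 := by positivity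
  have hBpos : 0 < B := by linarith
  have hfix : B * c / (B + c) + X ^ 2 ≤ B := by
    have hs := Real.sq_sqrt (show 0 ≤ X ^ 4 + 4 * X ^ 2 * c by positivity)
    have hs0 := Real.sqrt_nonneg (X ^ 4 + 4 * X ^ 2 * c)
    set s := Real.sqrt (X ^ 4 + 4 * X ^ 2 * c)
    have h1 : s ≤ 2 * B - X ^ 2 := by linarith
    have h2 : s ^ 2 ≤ (2 * B - X ^ 2) ^ 2 := pow_le_pow_left₀ hs0 h1 2
    have h3 : B * c / (B + c) ≤ B - X ^ 2 := by
      rw [div_le_iff₀ (by positivity)]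
      nlinarith
    linarith
  intro k hk
  induction k, hk using Nat.le_induction with
  | base =>
    have hcb : 0 < c - b := sub_pos.2 hbc
    have h := step 0 (b * c / (c - b)) (by positivity) (by
      simp [lasecD, Matrix.trace_smul, mul_comm])
    have h2 : b * c / (c - b) * c / (b * c / (c - b) + c) = b := by
      have : b * c / (c - b) + c = c * c / (c - b) := by
        field_simp
        ring
      rw [this]
      field_simp
    rw [h2] at h
    exact h.trans (mul_le_mul_of_nonneg_left hB2 (by positivity))
  | succ k hk ih =>
    exact (step k B hBpos ih).trans (mul_le_mul_of_nonneg_left hfix (by positivity))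

end
end

section
/- (Corollary 4, tuned LASEC bound.) Let T ≥ m ≥ 1, X > 0, 0 < ε < 1. Suppose ‖x_k‖² ≤ X² for all k, y_k ∈ {−1, +1} and y_k p̂_k ≤ 0 for every k = 1, …, m. Let μ = max{ (9/8) X² , (b + X²)²/(8X²) }, suppose 0 < V_m ≤ T·√2·d·X / μ^{3/2}, set c = (√2 T d X / V_m)^{2/3} and b = ε c. Then for every γ > 0, m ≤ (1/γ) D + (1/(2γ²)) A C + (1/γ) √( (1/γ) D A C + (1/(4γ²)) (A C)² + A B ), where D = Σ_{k=1}^{m} ℓ_{γ,k}(u_k), A = b‖u_1‖² + (√2 d X)^{2/3} T^{2/3} V_m^{1/3} + Σ_{k=1}^{m} (u_kᵀ x_k)², B = ln det((1/b) D_m) + (ε/(1−ε)) d, and C = (4 d X)^{2/3} T^{−1/3} V_m^{1/3}. -/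
set_option autoImplicit false

open Matrix Finset

noncomputable section

/-- `e_0 = 0`, `e_k = (I + c⁻¹ D_{k-1})⁻¹ e_{k-1} + y_k x_k` for `k ≥ 1`. -/
def lasecE (d : ℕ) (b c : ℝ) (x : ℕ → Fin d → ℝ) (y : ℕ → ℝ) : ℕ → (Fin d → ℝ)
  | 0 => 0
  | k + 1 => ((1 : Matrix (Fin d) (Fin d) ℝ) + c⁻¹ • lasecD d b c x k)⁻¹ *ᵥ
        lasecE d b c x y k + y (k + 1) • x (k + 1)

/-- The margin `p̂_k = x_kᵀ D_k⁻¹ (I + c⁻¹ D_{k-1})⁻¹ e_{k-1}`. -/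
def lasecPhat (d : ℕ) (b c : ℝ) (x : ℕ → Fin d → ℝ) (y : ℕ → ℝ) (k : ℕ) : ℝ :=
  x k ⬝ᵥ ((lasecD d b c x k)⁻¹ *ᵥ
    (((1 : Matrix (Fin d) (Fin d) ℝ) + c⁻¹ • lasecD d b c x (k - 1))⁻¹ *ᵥ
      lasecE d b c x y (k - 1)))


/-- The hinge loss `ℓ_{γ,k}(u) = max{0, γ - y_k uᵀ x_k}`. -/
def hinge (d : ℕ) (x : ℕ → Fin d → ℝ) (y : ℕ → ℝ) (γ : ℝ) (k : ℕ) (u : Fin d → ℝ) : ℝ :=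
  max 0 (γ - y k * (u ⬝ᵥ x k))

section helpers
variable {n : ℕ}

lemma las_sym {P : Matrix (Fin n) (Fin n) ℝ} (hP : P.PosDef) (v w : Fin n → ℝ) :
    v ⬝ᵥ (P *ᵥ w) = w ⬝ᵥ (P *ᵥ v) := by
  have h : Pᵀ = P := by simpa [Matrix.IsHermitian] using hP.1
  rw [dotProduct_mulVec, ← mulVec_transpose, h, dotProduct_comm]

lemma las_nonneg {P : Matrix (Fin n) (Fin n) ℝ} (hP : P.PosDef) (v : Fin n → ℝ) :
    0 ≤ v ⬝ᵥ (P *ᵥ v) := by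
  simpa using hP.posSemidef.dotProduct_mulVec_nonneg v

lemma las_unit {P : Matrix (Fin n) (Fin n) ℝ} (hP : P.PosDef) : IsUnit P.det :=
  (Matrix.isUnit_iff_isUnit_det P).1 hP.isUnit

lemma las_fenchel {P : Matrix (Fin n) (Fin n) ℝ} (hP : P.PosDef) (v r : Fin n → ℝ) :
    2 * (v ⬝ᵥ r) ≤ v ⬝ᵥ (P *ᵥ v) + r ⬝ᵥ (P⁻¹ *ᵥ r) := by
  have h := las_nonneg hP (v - P⁻¹ *ᵥ r)
  have h1 : P *ᵥ (P⁻¹ *ᵥ r) = r := by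
    rw [mulVec_mulVec, mul_nonsing_inv _ (las_unit hP), one_mulVec]
  have h2 := las_sym hP (P⁻¹ *ᵥ r) v
  rw [mulVec_sub, dotProduct_sub, sub_dotProduct, sub_dotProduct, h1] at h
  rw [h1] at h2
  rw [dotProduct_comm r]
  linarith

lemma las_vmv (x v : Fin n → ℝ) : v ⬝ᵥ (vecMulVec x x *ᵥ v) = (v ⬝ᵥ x) ^ 2 := by
  rw [vecMulVec_mulVec, dotProduct_comm x v]
  simp [dotProduct_smul]
  ring

lemma las_add_pd {M : Matrix (Fin n) (Fin n) ℝ} (hM : M.PosDef) (x : Fin n → ℝ) :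
    (M + vecMulVec x x).PosDef := by
  refine hM.add_posSemidef ?_
  simpa using Matrix.posSemidef_vecMulVec_self_star x

lemma las_log {M : Matrix (Fin n) (Fin n) ℝ} (hM : M.PosDef) (x : Fin n → ℝ) :
    x ⬝ᵥ ((M + vecMulVec x x)⁻¹ *ᵥ x) ≤
      Real.log (M + vecMulVec x x).det - Real.log M.det := by
  have hD := las_add_pd hM x
  set D := M + vecMulVec x x with hDd
  have h1 : M = D + replicateCol Unit (-x) * replicateRow Unit x := by
    rw [← vecMulVec_eq, neg_vecMulVec, hDd]; simp
  have h2 := Matrix.det_add_replicateCol_mul_replicateRow (ι := Unit) (las_unit hD) (-x) x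
  rw [← h1] at h2
  have h3 : (1 + replicateRow Unit x * D⁻¹ * replicateCol Unit (-x)).det
      = 1 - x ⬝ᵥ (D⁻¹ *ᵥ x) := by
    rw [det_unique]
    rw [Matrix.mul_assoc]
    simp only [Matrix.add_apply, one_apply_eq]
    rw [sub_eq_add_neg]
    congr 1
    rw [← replicateCol_mulVec, mulVec_neg, ← dotProduct_neg]
    rfl
  rw [h3] at h2
  have hp1 := hM.det_pos
  have hp2 := hD.det_pos
  have h4 : 0 < 1 - x ⬝ᵥ (D⁻¹ *ᵥ x) := by
    rw [h2] at hp1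
    exact (pos_iff_pos_of_mul_pos hp1).1 hp2
  rw [h2, Real.log_mul hp2.ne' h4.ne']
  have := Real.log_le_sub_one_of_pos h4
  linarith

lemma las_step {M : Matrix (Fin n) (Fin n) ℝ} (hM : M.PosDef) (x f : Fin n → ℝ) (y : ℝ)
    (hy : y = -1 ∨ y = 1) (h : y * (x ⬝ᵥ ((M + vecMulVec x x)⁻¹ *ᵥ f)) ≤ 0) :
    (f + y • x) ⬝ᵥ ((M + vecMulVec x x)⁻¹ *ᵥ (f + y • x)) ≤
      f ⬝ᵥ (M⁻¹ *ᵥ f) + Real.log (M + vecMulVec x x).det - Real.log M.det := by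
  have hl := las_log hM x
  have hD := las_add_pd hM x
  have hmon : f ⬝ᵥ ((M + vecMulVec x x)⁻¹ *ᵥ f) ≤ f ⬝ᵥ (M⁻¹ *ᵥ f) := by
    set a := (M + vecMulVec x x)⁻¹ *ᵥ f with ha
    have h1 : (M + vecMulVec x x) *ᵥ a = f := by
      rw [ha, mulVec_mulVec, mul_nonsing_inv _ (las_unit hD), one_mulVec]
    have h2 := las_fenchel hM a f
    have h3 : a ⬝ᵥ ((M + vecMulVec x x) *ᵥ a) = a ⬝ᵥ (M *ᵥ a) + (a ⬝ᵥ x) ^ 2 := by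
      rw [add_mulVec, dotProduct_add, las_vmv]
    rw [h1] at h3
    rw [dotProduct_comm f a]
    nlinarith [sq_nonneg (a ⬝ᵥ x)]
  have hs := las_sym hD.inv x f
  have hy2 : y * y = 1 := by rcases hy with h | h <;> rw [h] <;> norm_num
  rw [mulVec_add, mulVec_smul, dotProduct_add, add_dotProduct, add_dotProduct]
  simp only [smul_dotProduct, dotProduct_smul, smul_eq_mul]
  rw [← hs, ← mul_assoc, hy2]
  linarith

lemma las_pdc {D : Matrix (Fin n) (Fin n) ℝ} (hD : D.PosDef) {c : ℝ} (hc : 0 < c) :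
    (D + c • (1 : Matrix (Fin n) (Fin n) ℝ)).PosDef :=
  hD.add (PosDef.one.smul hc)

lemma las_M {D : Matrix (Fin n) (Fin n) ℝ} (hD : D.PosDef) {c : ℝ} (hc : 0 < c) :
    (D⁻¹ + c⁻¹ • (1 : Matrix (Fin n) (Fin n) ℝ))⁻¹
      = c • 1 - (c ^ 2) • (D + c • (1 : Matrix (Fin n) (Fin n) ℝ))⁻¹ := by
  have hu := las_unit (las_pdc hD hc)
  have hu' := las_unit hD
  set R := (D + c • (1 : Matrix (Fin n) (Fin n) ℝ))⁻¹ with hR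
  have h1 : (D + c • (1 : Matrix (Fin n) (Fin n) ℝ)) * R = 1 := mul_nonsing_inv _ hu
  apply inv_eq_right_inv
  have h2 : D * R = 1 - c • R := by
    rw [add_mul, smul_mul_assoc, one_mul] at h1
    rw [← h1]; simp
  have h3 : c • (D⁻¹ * R) = D⁻¹ - R := by
    have := congrArg (fun Z => D⁻¹ * Z) h2
    simp only [← mul_assoc, nonsing_inv_mul _ hu', one_mul, mul_sub, mul_one,
      mul_smul_comm] at this
    rw [eq_sub_iff_add_eq, add_comm, ← eq_sub_iff_add_eq]; exact this
  have h4 : (c ^ 2) • (D⁻¹ * R) = c • D⁻¹ - c • R := by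
    rw [pow_two, mul_smul, h3, smul_sub]
  rw [add_mul, mul_sub, mul_sub]
  simp only [mul_smul_comm, smul_mul_assoc, mul_one, one_mul, smul_smul]
  rw [h4, mul_inv_cancel₀ hc.ne',
    show c ^ 2 * c⁻¹ = c by field_simp]
  simp

lemma las_F {D : Matrix (Fin n) (Fin n) ℝ} (hD : D.PosDef) {c : ℝ} (hc : 0 < c) :
    ((1 : Matrix (Fin n) (Fin n) ℝ) + c⁻¹ • D)⁻¹
      = c • (D + c • (1 : Matrix (Fin n) (Fin n) ℝ))⁻¹ := by
  have hu := las_unit (las_pdc hD hc)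
  apply inv_eq_right_inv
  have h1 := mul_nonsing_inv _ hu
  have h5 : (1 : Matrix (Fin n) (Fin n) ℝ) + c⁻¹ • D = c⁻¹ • (D + c • 1) := by
    rw [smul_add, smul_smul, inv_mul_cancel₀ hc.ne', one_smul, add_comm]
  rw [h5, smul_mul_assoc, mul_smul_comm, h1, smul_smul, inv_mul_cancel₀ hc.ne', one_smul]

lemma las_M_pd {D : Matrix (Fin n) (Fin n) ℝ} (hD : D.PosDef) {c : ℝ} (hc : 0 < c) :
    (D⁻¹ + c⁻¹ • (1 : Matrix (Fin n) (Fin n) ℝ))⁻¹.PosDef :=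
  (hD.inv.add (PosDef.one.smul (inv_pos.2 hc))).inv

lemma las_fMf {D : Matrix (Fin n) (Fin n) ℝ} (hD : D.PosDef) {c : ℝ} (hc : 0 < c)
    (e : Fin n → ℝ) :
    (((1 : Matrix (Fin n) (Fin n) ℝ) + c⁻¹ • D)⁻¹ *ᵥ e) ⬝ᵥ
      (((D⁻¹ + c⁻¹ • (1 : Matrix (Fin n) (Fin n) ℝ))⁻¹)⁻¹ *ᵥ
        (((1 : Matrix (Fin n) (Fin n) ℝ) + c⁻¹ • D)⁻¹ *ᵥ e))
      = e ⬝ᵥ (D⁻¹ *ᵥ e) - e ⬝ᵥ ((D + c • (1 : Matrix (Fin n) (Fin n) ℝ))⁻¹ *ᵥ e) := by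
  have hN := hD.inv.add ((PosDef.one (n := Fin n) (R := ℝ)).smul (inv_pos.2 hc))
  rw [nonsing_inv_nonsing_inv _ (las_unit hN), las_F hD hc]
  have hu := las_unit (las_pdc hD hc)
  have hRp := (las_pdc hD hc).inv
  have hu' := las_unit hD
  set R := (D + c • (1 : Matrix (Fin n) (Fin n) ℝ))⁻¹ with hR
  have h1 : R * (D + c • (1 : Matrix (Fin n) (Fin n) ℝ)) = 1 := nonsing_inv_mul _ hu
  have h1' : (D + c • (1 : Matrix (Fin n) (Fin n) ℝ)) * R = 1 := mul_nonsing_inv _ hu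
  have h2 : (D⁻¹ + c⁻¹ • (1 : Matrix (Fin n) (Fin n) ℝ)) * (c • R) = D⁻¹ := by
    have : (D⁻¹ + c⁻¹ • (1 : Matrix (Fin n) (Fin n) ℝ)) = c⁻¹ • (D⁻¹ * (D + c • 1)) := by
      rw [mul_add, nonsing_inv_mul _ hu', mul_smul_comm, mul_one, smul_add, smul_smul,
        inv_mul_cancel₀ hc.ne', one_smul, add_comm]
    rw [this, smul_mul_assoc, mul_smul_comm, mul_assoc, h1', smul_smul,
      inv_mul_cancel₀ hc.ne', one_smul, mul_one]
  have h3 : c • (R * D⁻¹) = D⁻¹ - R := by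
    rw [mul_add, mul_smul_comm, mul_one] at h1
    have := congrArg (fun Z => Z * D⁻¹) h1
    simp only [add_mul, mul_assoc, mul_nonsing_inv _ hu', one_mul, mul_one,
      smul_mul_assoc] at this
    rw [eq_sub_iff_add_eq, add_comm]; exact this
  rw [mulVec_mulVec, h2, smul_mulVec, smul_dotProduct, dotProduct_comm, las_sym hRp,
    mulVec_mulVec, ← dotProduct_smul, ← smul_mulVec, h3, sub_mulVec, dotProduct_sub]

/-- partial minimisation over the previous comparator -/
lemma las_min {D : Matrix (Fin n) (Fin n) ℝ} (hD : D.PosDef) {c : ℝ} (hc : 0 < c)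
    (e u v : Fin n → ℝ) :
    u ⬝ᵥ ((D⁻¹ + c⁻¹ • (1 : Matrix (Fin n) (Fin n) ℝ))⁻¹ *ᵥ u)
      - 2 * (u ⬝ᵥ (((1 : Matrix (Fin n) (Fin n) ℝ) + c⁻¹ • D)⁻¹ *ᵥ e))
      - e ⬝ᵥ ((D + c • (1 : Matrix (Fin n) (Fin n) ℝ))⁻¹ *ᵥ e)
    ≤ v ⬝ᵥ (D *ᵥ v) - 2 * (v ⬝ᵥ e) + c * ((u - v) ⬝ᵥ (u - v)) := by
  have hP := las_pdc hD hc
  have h := las_fenchel hP v (e + c • u)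
  have hs := las_sym hP.inv u e
  rw [las_M hD hc, las_F hD hc]
  set R := (D + c • (1 : Matrix (Fin n) (Fin n) ℝ))⁻¹ with hR
  simp only [add_mulVec, sub_mulVec, smul_mulVec, one_mulVec, mulVec_add, mulVec_smul,
    dotProduct_add, add_dotProduct, dotProduct_sub, sub_dotProduct, dotProduct_smul,
    smul_dotProduct, smul_eq_mul] at h ⊢
  have h2 := dotProduct_comm u v
  rw [h2]
  rw [← hs] at h
  linarith

lemma las_Mbd {D : Matrix (Fin n) (Fin n) ℝ} (hD : D.PosDef) {c L X : ℝ} (hc : 0 < c)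
    (hL : 0 < L) (hLX : L * c / (L + c) + X ^ 2 ≤ L)
    (h : ∀ v, v ⬝ᵥ (D *ᵥ v) ≤ L * (v ⬝ᵥ v)) (x : Fin n → ℝ) (hx : x ⬝ᵥ x ≤ X ^ 2)
    (v : Fin n → ℝ) :
    v ⬝ᵥ (((D⁻¹ + c⁻¹ • (1 : Matrix (Fin n) (Fin n) ℝ))⁻¹ + vecMulVec x x) *ᵥ v)
      ≤ L * (v ⬝ᵥ v) := by
  have hP := las_pdc hD hc
  have hf := las_fenchel hP ((L + c)⁻¹ • v) v
  rw [las_M hD hc]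
  set R := (D + c • (1 : Matrix (Fin n) (Fin n) ℝ))⁻¹ with hR
  rw [add_mulVec, dotProduct_add, las_vmv]
  have hcs : (v ⬝ᵥ x) ^ 2 ≤ X ^ 2 * (v ⬝ᵥ v) := by
    have h1 : (v ⬝ᵥ x) ^ 2 ≤ (v ⬝ᵥ v) * (x ⬝ᵥ x) := by
      have := Finset.sum_mul_sq_le_sq_mul_sq Finset.univ v x
      simpa [dotProduct, pow_two] using this
    have h2 : 0 ≤ v ⬝ᵥ v := by
      simpa using dotProduct_star_self_nonneg v
    nlinarith
  simp only [add_mulVec, sub_mulVec, smul_mulVec, one_mulVec, mulVec_smul,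
    dotProduct_add, dotProduct_sub, dotProduct_smul,
    smul_dotProduct, smul_eq_mul] at hf ⊢
  have hLc : 0 < L + c := by linarith
  have h2 : 0 ≤ v ⬝ᵥ v := by
    simpa using dotProduct_star_self_nonneg v
  have hv := h v
  set q := v ⬝ᵥ v with hq
  set w := v ⬝ᵥ (D *ᵥ v) with hw
  set r := v ⬝ᵥ (R *ᵥ v) with hr
  have h3 : (L + c)⁻¹ * q ≤ r := by
    have h4 : (L + c)⁻¹ * ((L + c)⁻¹ * w) ≤ (L + c)⁻¹ * ((L + c)⁻¹ * (L * q)) := by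
      gcongr
    have h5 : (L + c)⁻¹ * ((L + c)⁻¹ * (L * q)) + (L + c)⁻¹ * (c * ((L + c)⁻¹ * q))
      = (L + c)⁻¹ * q := by field_simp
    have h6 : (L + c)⁻¹ * (c * ((L + c)⁻¹ * q)) = c * ((L + c)⁻¹ * ((L + c)⁻¹ * q)) := by ring
    linarith
  have h7 : c ^ 2 * ((L + c)⁻¹ * q) ≤ c ^ 2 * r := by gcongr
  have h8 : c * q - c ^ 2 * ((L + c)⁻¹ * q) = L * c / (L + c) * q := by
    field_simp; ring
  have h9 := mul_le_mul_of_nonneg_right hLX h2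
  linarith

lemma las_det {P : Matrix (Fin n) (Fin n) ℝ} (hP : P.PosDef) {q : ℝ}
    (h : ∀ v, v ⬝ᵥ (P *ᵥ v) ≤ q * (v ⬝ᵥ v)) : P.det ≤ q ^ n := by
  have h1 : P.det = ∏ i, hP.1.eigenvalues i := by
    simpa using hP.1.det_eq_prod_eigenvalues
  rw [h1]
  have h2 : ∏ i : Fin n, hP.1.eigenvalues i ≤ ∏ i : Fin n, q := by
    apply Finset.prod_le_prod
    · intro i _; exact (hP.eigenvalues_pos i).le
    · intro i _
      rw [hP.1.eigenvalues_eq i]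
      have h3 := h (⇑(hP.1.eigenvectorBasis i))
      have h4 : (⇑(hP.1.eigenvectorBasis i) : Fin n → ℝ) ⬝ᵥ ⇑(hP.1.eigenvectorBasis i) = 1 := by
        have h5 := hP.1.eigenvectorBasis.orthonormal.1 i
        have h6 := EuclideanSpace.real_norm_sq_eq (hP.1.eigenvectorBasis i)
        rw [h5] at h6
        simp [dotProduct, ← pow_two, ← h6]
      rw [h4] at h3
      simpa using h3
  simpa using h2

lemma las_logM {D : Matrix (Fin n) (Fin n) ℝ} (hD : D.PosDef) {c L : ℝ} (hc : 0 < c)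
    (hL : 0 < L) (h : ∀ v, v ⬝ᵥ (D *ᵥ v) ≤ L * (v ⬝ᵥ v)) :
    Real.log D.det - n * L / c ≤
      Real.log ((D⁻¹ + c⁻¹ • (1 : Matrix (Fin n) (Fin n) ℝ))⁻¹).det := by
  have hMp := las_M_pd hD hc
  have hI : ((1 : Matrix (Fin n) (Fin n) ℝ) + c⁻¹ • D).PosDef :=
    PosDef.one.add (hD.smul (inv_pos.2 hc))
  have h1 : (D⁻¹ + c⁻¹ • (1 : Matrix (Fin n) (Fin n) ℝ))⁻¹ *
      ((1 : Matrix (Fin n) (Fin n) ℝ) + c⁻¹ • D) = D := by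
    have h2 : (1 : Matrix (Fin n) (Fin n) ℝ) + c⁻¹ • D
        = (D⁻¹ + c⁻¹ • (1 : Matrix (Fin n) (Fin n) ℝ)) * D := by
      rw [add_mul, nonsing_inv_mul _ (las_unit hD), smul_mul_assoc, one_mul]
    have hN := hD.inv.add ((PosDef.one (n := Fin n) (R := ℝ)).smul (inv_pos.2 hc))
    rw [h2, ← mul_assoc, nonsing_inv_mul _ (las_unit hN), one_mul]
  have h3 := congrArg Matrix.det h1
  rw [det_mul] at h3
  rw [← h3, Real.log_mul hMp.det_pos.ne' hI.det_pos.ne']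
  have h4 : ((1 : Matrix (Fin n) (Fin n) ℝ) + c⁻¹ • D).det ≤ (1 + L / c) ^ n := by
    apply las_det hI
    intro v
    rw [add_mulVec, one_mulVec, smul_mulVec, dotProduct_add, dotProduct_smul, smul_eq_mul]
    have := mul_le_mul_of_nonneg_left (h v) (inv_pos.2 hc).le
    calc _ ≤ v ⬝ᵥ v + c⁻¹ * (L * v ⬝ᵥ v) := by linarith
      _ = _ := by field_simp
  have h5 := Real.log_le_log hI.det_pos h4
  rw [Real.log_pow] at h5
  have hLc : 0 < L / c := by positivity
  have h6 := Real.log_le_sub_one_of_pos (show 0 < 1 + L / c by linarith)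
  have h7 : (n : ℝ) * Real.log (1 + L / c) ≤ n * (L / c) := by gcongr; linarith
  rw [mul_div_assoc]
  linarith

end helpers

lemma las_base (d : ℕ) (b c : ℝ) (hb : 0 < b) (hbc : b < c) (x : ℕ → Fin d → ℝ) :
    ((lasecD d b c x 0)⁻¹ + c⁻¹ • (1 : Matrix (Fin d) (Fin d) ℝ))⁻¹ = b • 1 := by
  have hc : 0 < c := hb.trans hbc
  have hcb : 0 < c - b := by linarith
  have h0 : (lasecD d b c x 0)⁻¹ = ((c - b) / (b * c)) • (1 : Matrix (Fin d) (Fin d) ℝ) := by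
    apply inv_eq_right_inv
    rw [lasecD, smul_mul_assoc, one_mul, smul_smul,
      show b * c / (c - b) * ((c - b) / (b * c)) = 1 by field_simp, one_smul]
  apply inv_eq_right_inv
  rw [h0, ← add_smul, smul_mul_assoc, one_mul, smul_smul,
    show ((c - b) / (b * c) + c⁻¹) * b = 1 by field_simp; ring, one_smul]

def lasQ (d : ℕ) (b c : ℝ) (x : ℕ → Fin d → ℝ) (y : ℕ → ℝ) (w : ℕ → Fin d → ℝ) (m : ℕ) : ℝ :=
  b * (w 1 ⬝ᵥ w 1) + c * (∑ k ∈ Icc 2 m, (w k - w (k - 1)) ⬝ᵥ (w k - w (k - 1)))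
    + ∑ k ∈ Icc 1 m, ((w k ⬝ᵥ x k) ^ 2 - 2 * (y k * (w k ⬝ᵥ x k)))

lemma las_main (d : ℕ) (b c L X : ℝ) (hb : 0 < b) (hbc : b < c) (x : ℕ → Fin d → ℝ)
    (y : ℕ → ℝ) (hL : 0 < L) (hbL : b + X ^ 2 ≤ L) (hLX : L * c / (L + c) + X ^ 2 ≤ L)
    (hx : ∀ k, x k ⬝ᵥ x k ≤ X ^ 2) (k : ℕ) :
    (∀ j ∈ Icc 1 (k + 1), y j = -1 ∨ y j = 1) →
    (∀ j ∈ Icc 1 (k + 1), y j * lasecPhat d b c x y j ≤ 0) →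
    (lasecD d b c x (k + 1)).PosDef ∧
    (∀ v, v ⬝ᵥ (lasecD d b c x (k + 1) *ᵥ v) ≤ L * (v ⬝ᵥ v)) ∧
    ∃ g : ℝ, (∀ w : ℕ → Fin d → ℝ,
      w (k + 1) ⬝ᵥ (lasecD d b c x (k + 1) *ᵥ w (k + 1))
        - 2 * (w (k + 1) ⬝ᵥ lasecE d b c x y (k + 1)) - g ≤ lasQ d b c x y w (k + 1)) ∧
      g + lasecE d b c x y (k + 1) ⬝ᵥ ((lasecD d b c x (k + 1))⁻¹ *ᵥ lasecE d b c x y (k + 1))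
        ≤ Real.log (lasecD d b c x (k + 1)).det - d * Real.log b + k * (d * L / c) := by
  have hc : 0 < c := hb.trans hbc
  induction k with
  | zero =>
    intro hy hmis
    have hy1 := hy 1 (by simp)
    have hmis1 := hmis 1 (by simp)
    have hbI : (b • (1 : Matrix (Fin d) (Fin d) ℝ)).PosDef := PosDef.one.smul hb
    have hD : lasecD d b c x (0 + 1) = b • 1 + vecMulVec (x 1) (x 1) := by
      rw [lasecD, las_base d b c hb hbc x]
    have hE : lasecE d b c x y (0 + 1) = 0 + y 1 • x 1 := by
      rw [lasecE, lasecE, mulVec_zero]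
    have hq : ∀ v : Fin d → ℝ, v ⬝ᵥ ((b • 1 + vecMulVec (x 1) (x 1)) *ᵥ v)
        = b * (v ⬝ᵥ v) + (v ⬝ᵥ x 1) ^ 2 := by
      intro v
      rw [add_mulVec, dotProduct_add, las_vmv, smul_mulVec, one_mulVec, dotProduct_smul,
        smul_eq_mul]
    rw [hD, hE]
    refine ⟨las_add_pd hbI _, ?_, 0, ?_, ?_⟩
    · intro v
      rw [hq]
      have h1 : (v ⬝ᵥ x 1) ^ 2 ≤ (v ⬝ᵥ v) * (x 1 ⬝ᵥ x 1) := by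
        have := Finset.sum_mul_sq_le_sq_mul_sq Finset.univ v (x 1)
        simpa [dotProduct, pow_two] using this
      have h2 : 0 ≤ v ⬝ᵥ v := by
        simpa using dotProduct_star_self_nonneg v
      nlinarith [hx 1]
    · intro w
      rw [zero_add, hq]
      simp [lasQ]
      linarith
    · have h := las_step hbI (x 1) 0 (y 1) hy1 (by simp)
      rw [det_smul, det_one] at h
      simp at h ⊢
      linarith
  | succ k ih =>
    intro hy hmis
    obtain ⟨hpd, hbd, g, hg, hS⟩ := ih
      (fun j hj => hy j (by simp at hj ⊢; omega)) (fun j hj => hmis j (by simp at hj ⊢; omega))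
    have hy1 := hy (k + 1 + 1) (by simp)
    have hmis1 := hmis (k + 1 + 1) (by simp)
    rw [lasecPhat] at hmis1
    simp only [Nat.add_sub_cancel] at hmis1
    rw [lasecE]
    rw [lasecD] at hmis1 ⊢
    set D := lasecD d b c x (k + 1) with hD
    set e := lasecE d b c x y (k + 1) with he
    have hM := las_M_pd hpd hc
    refine ⟨las_add_pd hM _, las_Mbd hpd hc hL hLX hbd _ (hx _),
      g + e ⬝ᵥ ((D + c • (1 : Matrix (Fin d) (Fin d) ℝ))⁻¹ *ᵥ e), ?_, ?_⟩
    · intro w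
      have h1 := hg w
      have h2 := las_min hpd hc e (w (k + 1 + 1)) (w (k + 1))
      have h3 : lasQ d b c x y w (k + 1 + 1) = lasQ d b c x y w (k + 1)
          + c * ((w (k + 1 + 1) - w (k + 1)) ⬝ᵥ (w (k + 1 + 1) - w (k + 1)))
          + ((w (k + 1 + 1) ⬝ᵥ x (k + 1 + 1)) ^ 2
            - 2 * (y (k + 1 + 1) * (w (k + 1 + 1) ⬝ᵥ x (k + 1 + 1)))) := by
        rw [lasQ, lasQ, Finset.sum_Icc_succ_top (show 2 ≤ k + 1 + 1 by omega),
          Finset.sum_Icc_succ_top (show 1 ≤ k + 1 + 1 by omega)]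
        simp only [Nat.add_sub_cancel]
        ring
      rw [h3, add_mulVec, dotProduct_add, las_vmv, dotProduct_add, dotProduct_smul, smul_eq_mul]
      linarith
    · have h1 := las_step hM (x (k + 1 + 1)) _ (y (k + 1 + 1)) hy1 hmis1
      rw [las_fMf hpd hc] at h1
      have h2 := las_logM hpd hc hL hbd
      push_cast
      linarith

lemma las_final (d : ℕ) (b c L X : ℝ) (hb : 0 < b) (hbc : b < c) (x : ℕ → Fin d → ℝ)
    (y : ℕ → ℝ) (hL : 0 < L) (hbL : b + X ^ 2 ≤ L) (hLX : L * c / (L + c) + X ^ 2 ≤ L)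
    (hx : ∀ k, x k ⬝ᵥ x k ≤ X ^ 2) (m : ℕ) (hm : 1 ≤ m)
    (hy : ∀ j ∈ Icc 1 m, y j = -1 ∨ y j = 1)
    (hmis : ∀ j ∈ Icc 1 m, y j * lasecPhat d b c x y j ≤ 0)
    (w : ℕ → Fin d → ℝ) (A : ℝ) (hA0 : 0 < A)
    (hA : A = b * (w 1 ⬝ᵥ w 1) + c * (∑ k ∈ Icc 2 m, (w k - w (k - 1)) ⬝ᵥ (w k - w (k - 1)))
      + ∑ k ∈ Icc 1 m, (w k ⬝ᵥ x k) ^ 2) :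
    (∑ k ∈ Icc 1 m, y k * (w k ⬝ᵥ x k)) ^ 2 ≤
      A * (Real.log ((b⁻¹ • lasecD d b c x m).det) + m * (d * L / c)) := by
  obtain ⟨k, rfl⟩ : ∃ k, m = k + 1 := ⟨m - 1, by omega⟩
  obtain ⟨hpd, -, g, hg, hS⟩ := las_main d b c L X hb hbc x y hL hbL hLX hx k hy hmis
  set s := ∑ k ∈ Icc 1 (k + 1), y k * (w k ⬝ᵥ x k) with hs
  have hlog : Real.log ((b⁻¹ • lasecD d b c x (k + 1)).det)
      = Real.log (lasecD d b c x (k + 1)).det - d * Real.log b := by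
    rw [det_smul, Real.log_mul (by positivity) hpd.det_pos.ne', Real.log_pow, Real.log_inv]
    simp; ring
  have hc : 0 < c := hb.trans hbc
  have h1 : 2 * (s / A) * s - (s / A) ^ 2 * A ≤
      Real.log ((b⁻¹ • lasecD d b c x (k + 1)).det) + (k + 1 : ℕ) * (d * L / c) := by
    set t := s / A
    have hq : lasQ d b c x y (fun k => t • w k) (k + 1) = t ^ 2 * A - 2 * t * s := by
      rw [hA, hs, lasQ]
      simp only [← smul_sub, dotProduct_smul, smul_dotProduct, smul_eq_mul]
      rw [Finset.sum_sub_distrib, mul_add, mul_add]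
      simp only [Finset.mul_sum]
      have e1 : ∀ i, c * (t * (t * (w i - w (i - 1)) ⬝ᵥ (w i - w (i - 1))))
        = t ^ 2 * (c * (w i - w (i - 1)) ⬝ᵥ (w i - w (i - 1))) := fun i => by ring
      have e2 : ∀ i, (t * w i ⬝ᵥ x i) ^ 2 = t ^ 2 * (w i ⬝ᵥ x i) ^ 2 := fun i => by ring
      have e3 : ∀ i, 2 * (y i * (t * w i ⬝ᵥ x i)) = 2 * t * (y i * w i ⬝ᵥ x i) :=
        fun i => by ring
      simp only [e1, e2, e3]
      ring
    have h2 := hg (fun k => t • w k)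
    rw [hq] at h2
    have h3 := las_fenchel hpd (t • w (k + 1)) (lasecE d b c x y (k + 1))
    have h4 : 0 ≤ (d * L / c : ℝ) := by positivity
    rw [hlog]
    push_cast
    linarith
  have h5 : 2 * (s / A) * s - (s / A) ^ 2 * A = s ^ 2 / A := by field_simp; ring
  rw [h5, div_le_iff₀ hA0] at h1
  linarith

set_option maxHeartbeats 1000000 in
/-- Corollary 4, tuned LASEC bound. -/
theorem lasec_tuned_bound (d : ℕ) (hd : 1 ≤ d) (T m : ℕ) (hm : 1 ≤ m) (hmT : m ≤ T)
    (X ε : ℝ) (hX : 0 < X) (hε0 : 0 < ε) (hε1 : ε < 1)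
    (x : ℕ → Fin d → ℝ) (hx : ∀ k : ℕ, (∑ i, (x k i) ^ 2) ≤ X ^ 2)
    (u : ℕ → Fin d → ℝ)
    (Vm : ℝ) (hVm : Vm = ∑ k ∈ Icc 2 m, ∑ i, (u k i - u (k - 1) i) ^ 2)
    (b c : ℝ) (hc : c = (Real.sqrt 2 * T * d * X / Vm) ^ ((2 : ℝ) / 3)) (hb : b = ε * c)
    (μ : ℝ) (hμ : μ = max ((9 / 8) * X ^ 2) ((b + X ^ 2) ^ 2 / (8 * X ^ 2)))
    (hV0 : 0 < Vm) (hV : Vm ≤ (T : ℝ) * Real.sqrt 2 * d * X / μ ^ ((3 : ℝ) / 2))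
    (y : ℕ → ℝ) (hy : ∀ k ∈ Icc 1 m, y k = -1 ∨ y k = 1)
    (hmis : ∀ k ∈ Icc 1 m, y k * lasecPhat d b c x y k ≤ 0)
    (γ : ℝ) (hγ : 0 < γ)
    (A B C D : ℝ)
    (hA : A = b * (∑ i, (u 1 i) ^ 2)
        + (Real.sqrt 2 * d * X) ^ ((2 : ℝ) / 3) * (T : ℝ) ^ ((2 : ℝ) / 3) * Vm ^ ((1 : ℝ) / 3)
        + ∑ k ∈ Icc 1 m, (u k ⬝ᵥ x k) ^ 2)
    (hB : B = Real.log ((b⁻¹ • lasecD d b c x m).det) + (ε / (1 - ε)) * d)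
    (hC : C = (4 * d * X) ^ ((2 : ℝ) / 3) * (T : ℝ) ^ (-(1 : ℝ) / 3) * Vm ^ ((1 : ℝ) / 3))
    (hD : D = ∑ k ∈ Icc 1 m, hinge d x y γ k (u k)) :
    (m : ℝ) ≤ (1 / γ) * D + (1 / (2 * γ ^ 2)) * (A * C)
      + (1 / γ) * Real.sqrt
          ((1 / γ) * D * A * C + (1 / (4 * γ ^ 2)) * (A * C) ^ 2 + A * B) := by
  have hdR : (1 : ℝ) ≤ d := by exact_mod_cast hd
  have hTR : (1 : ℝ) ≤ T := by exact_mod_cast hm.trans hmT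
  have hd0 : (0 : ℝ) < d := by linarith
  have hT0 : (0 : ℝ) < T := by linarith
  have h2 : 0 < Real.sqrt 2 := by positivity
  have h22 : Real.sqrt 2 ^ 2 = 2 := Real.sq_sqrt (by norm_num)
  have hq0 : 0 < Real.sqrt 2 * T * d * X / Vm := by positivity
  have cube : ∀ z : ℝ, 0 ≤ z → (z ^ ((2 : ℝ) / 3)) ^ 3 = z ^ 2 := by
    intro z hz
    rw [← Real.rpow_natCast, ← Real.rpow_mul hz, ← Real.rpow_natCast]; norm_num
  have cube1 : ∀ z : ℝ, 0 ≤ z → (z ^ ((1 : ℝ) / 3)) ^ 3 = z := by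
    intro z hz
    rw [← Real.rpow_natCast, ← Real.rpow_mul hz]; norm_num
  have cubem : ∀ z : ℝ, 0 ≤ z → (z ^ (-(1 : ℝ) / 3)) ^ 3 = z⁻¹ := by
    intro z hz
    rw [← Real.rpow_natCast, ← Real.rpow_mul hz, ← Real.rpow_neg_one]; norm_num
  have hc0 : 0 < c := by rw [hc]; positivity
  have hc3 : c ^ 3 = 2 * T ^ 2 * d ^ 2 * X ^ 2 / Vm ^ 2 := by
    rw [hc, cube _ hq0.le, div_pow, mul_pow, mul_pow, mul_pow, h22]
  have hb0 : 0 < b := by rw [hb]; positivity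
  have hbc : b < c := by rw [hb]; exact mul_lt_of_lt_one_left hc0 hε1
  have hμ0 : 0 < μ := by
    rw [hμ]; exact lt_max_of_lt_left (by positivity)
  have hμc : μ ≤ c := by
    have h3 : 0 < μ ^ ((3 : ℝ) / 2) := by positivity
    have h4 : μ ^ ((3 : ℝ) / 2) ≤ Real.sqrt 2 * T * d * X / Vm := by
      rw [le_div_iff₀ h3] at hV
      rw [le_div_iff₀ hV0]
      linarith
    have h5 := Real.rpow_le_rpow h3.le h4 (show (0 : ℝ) ≤ 2 / 3 by norm_num)
    rw [← hc, ← Real.rpow_mul hμ0.le] at h5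
    norm_num at h5
    exact h5
  have hc1 : 9 / 8 * X ^ 2 ≤ c := (le_max_left _ _).trans (hμ ▸ hμc)
  have hc2 : (b + X ^ 2) ^ 2 ≤ 8 * X ^ 2 * c := by
    have h3 : (b + X ^ 2) ^ 2 / (8 * X ^ 2) ≤ c := (le_max_right _ _).trans (hμ ▸ hμc)
    rw [div_le_iff₀ (by positivity)] at h3
    linarith
  obtain ⟨L, hLd⟩ : ∃ L, L = Real.sqrt (8 * X ^ 2 * c) := ⟨_, rfl⟩
  have hL : 0 < L := by rw [hLd]; positivity
  have hL2 : L ^ 2 = 8 * X ^ 2 * c := by rw [hLd]; exact Real.sq_sqrt (by positivity)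
  have hbL : b + X ^ 2 ≤ L := by rw [hLd]; exact Real.le_sqrt_of_sq_le hc2
  have hLX : L * c / (L + c) + X ^ 2 ≤ L := by
    have h3 : L ≤ 7 * c := by
      apply le_of_sq_le_sq _ (by positivity)
      rw [hL2]
      have := mul_le_mul_of_nonneg_left hc1 hc0.le
      have := mul_pos hc0 hc0
      linarith
    have h4 : X ^ 2 * (L + c) ≤ L ^ 2 := by
      rw [hL2]
      have := mul_le_mul_of_nonneg_left (show L + c ≤ 8 * c by linarith) (sq_nonneg X)
      linarith
    have h5 : X ^ 2 ≤ L ^ 2 / (L + c) := by rw [le_div_iff₀ (by positivity)]; exact h4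
    have h6 : L * c / (L + c) + L ^ 2 / (L + c) = L := by field_simp; ring
    linarith
  have hC0 : 0 < C := by rw [hC]; positivity
  have hCeq : d * L / c = C := by
    have h3 : C ^ 3 = 16 * d ^ 2 * X ^ 2 * Vm / T := by
      rw [hC, mul_pow, mul_pow, cube _ (by positivity), cubem _ hT0.le, cube1 _ hV0.le]
      ring
    have h4 : (d * L / c) ^ 6 = C ^ 6 := by
      have e1 : C ^ 6 = (C ^ 3) ^ 2 := by ring
      have e2 : (d * L / c) ^ 6 = d ^ 6 * (L ^ 2) ^ 3 / (c ^ 3 * c ^ 3) := by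
        rw [div_pow, mul_pow]; ring
      have e3 : (d : ℝ) ^ 6 * (L ^ 2) ^ 3 / (c ^ 3 * c ^ 3) = d ^ 6 * (512 * X ^ 6) / c ^ 3 := by
        rw [hL2]; field_simp; ring
      rw [e1, e2, e3, h3, hc3]
      field_simp; ring
    exact (pow_left_inj₀ (by positivity) hC0.le (by norm_num)).1 h4
  have hcV : c * Vm = (Real.sqrt 2 * d * X) ^ ((2 : ℝ) / 3) * (T : ℝ) ^ ((2 : ℝ) / 3)
      * Vm ^ ((1 : ℝ) / 3) := by
    refine (pow_left_inj₀ (by positivity) (by positivity) (show 3 ≠ 0 by norm_num)).1 ?_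
    rw [mul_pow, mul_pow, mul_pow, cube _ (by positivity), cube _ hT0.le, cube1 _ hV0.le, hc3,
      mul_pow, mul_pow, h22]
    field_simp
  have hA' : A = b * (u 1 ⬝ᵥ u 1)
      + c * (∑ k ∈ Icc 2 m, (u k - u (k - 1)) ⬝ᵥ (u k - u (k - 1)))
      + ∑ k ∈ Icc 1 m, (u k ⬝ᵥ x k) ^ 2 := by
    rw [hA, ← hcV, hVm]
    simp only [dotProduct, pow_two, Pi.sub_apply]
  have hA0 : 0 < A := by
    rw [hA, ← hcV]
    have e1 : 0 ≤ b * ∑ i, (u 1 i) ^ 2 := by positivity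
    have e2 : 0 < c * Vm := by positivity
    have e3 : 0 ≤ ∑ k ∈ Icc 1 m, (u k ⬝ᵥ x k) ^ 2 := by positivity
    linarith
  have hmain := las_final d b c L X hb0 hbc x y hL hbL hLX
    (fun k => by simpa [dotProduct, pow_two] using hx k) m hm hy hmis u A hA0 hA'
  rw [hCeq] at hmain
  set s := ∑ k ∈ Icc 1 m, y k * (u k ⬝ᵥ x k) with hs
  have hε : 0 ≤ ε / (1 - ε) * d := by
    have : 0 < 1 - ε := by linarith
    positivity
  have hmain2 : s ^ 2 ≤ A * (B + m * C) := by
    refine hmain.trans (mul_le_mul_of_nonneg_left ?_ hA0.le)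
    rw [hB]; linarith
  have hDs : γ * m - D ≤ s := by
    have h3 : ∑ k ∈ Icc 1 m, (γ - y k * (u k ⬝ᵥ x k)) ≤ D := by
      rw [hD]
      exact Finset.sum_le_sum fun k _ => le_max_right _ _
    rw [Finset.sum_sub_distrib] at h3
    simp at h3
    linarith
  have hAC : 0 < A * C := by positivity
  by_cases hcase : γ * m ≤ D
  · have h3 : (m : ℝ) ≤ 1 / γ * D := by
      rw [one_div, ← div_eq_inv_mul, le_div_iff₀ hγ]; linarith
    have h4 : 0 ≤ 1 / (2 * γ ^ 2) * (A * C) := by positivity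
    have h5 : 0 ≤ (1 / γ) * Real.sqrt
          ((1 / γ) * D * A * C + (1 / (4 * γ ^ 2)) * (A * C) ^ 2 + A * B) := by positivity
    linarith
  · push Not at hcase
    have h3 : (γ * m - D) ^ 2 ≤ A * (B + m * C) := by
      refine le_trans ?_ hmain2
      exact pow_le_pow_left₀ (by linarith) hDs 2
    have h4 : γ * m - D - A * C / (2 * γ) ≤ Real.sqrt
          ((1 / γ) * D * A * C + (1 / (4 * γ ^ 2)) * (A * C) ^ 2 + A * B) := by
      apply Real.le_sqrt_of_sq_le
      have h5 : (γ * m - D - A * C / (2 * γ)) ^ 2 = (γ * m - D) ^ 2 - A * C * m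
          + 1 / γ * D * A * C + (1 / (4 * γ ^ 2)) * (A * C) ^ 2 := by
        field_simp; ring
      rw [h5]; linarith
    have h6 := mul_le_mul_of_nonneg_left h4 (show 0 ≤ 1 / γ by positivity)
    have h7 : 1 / γ * (γ * m - D - A * C / (2 * γ)) = m - 1 / γ * D
        - 1 / (2 * γ ^ 2) * (A * C) := by field_simp
    linarith

end
end
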